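/- arXiv:1304.4368 — 3 statements merged into one kernel-verified Lean document; each statement's English description precedes it below -/
import Mathlib

section
/- For every integer M ≥ 1, every γ > 0 and every real x, the Fourier integral ∫_ℝ e^{-ikx} (γ² + k²)^{-M} dk equals f_M(x), i.e. ∫_ℝ e^{-ikx}/(γ²+k²)^M dk = (π/(γ^{2M-1} 2^{M-1} (M-1)!)) · e^{-γ|x|} · ∑_{l=0}^{M-1} ((M-1+l)!/(l! (M-1-l)! 2^l)) |γx|^{M-1-l}. -/
open MeasureTheory Finset

open scoped FourierTransform Nat

/-- The reverse Bessel polynomial of degree `n`, evaluated at `y`. -/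
noncomputable def reverseBessel (n : ℕ) (y : ℝ) : ℝ :=
  ∑ l ∈ range (n + 1), ((n + l)! : ℝ) / ((l ! : ℝ) * ((n - l)! : ℝ) * 2 ^ l) * y ^ (n - l)

lemma differentiable_reverseBessel (n : ℕ) : Differentiable ℝ (reverseBessel n) := by
  unfold reverseBessel
  fun_prop

lemma mul_deriv_reverseBessel (n : ℕ) (y : ℝ) :
    y * deriv (reverseBessel n) y =
      ∑ l ∈ range (n + 1), ((n - l : ℕ) : ℝ) *
        (((n + l)! : ℝ) / ((l ! : ℝ) * ((n - l)! : ℝ) * 2 ^ l) * y ^ (n - l)) := by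
  have h : HasDerivAt (reverseBessel n) (∑ l ∈ range (n + 1),
      ((n + l)! : ℝ) / ((l ! : ℝ) * ((n - l)! : ℝ) * 2 ^ l) *
        (((n - l : ℕ) : ℝ) * y ^ (n - l - 1))) y := by
    unfold reverseBessel
    exact HasDerivAt.fun_sum fun l _ => (hasDerivAt_pow (n - l) y).const_mul _
  rw [h.deriv, mul_sum]
  refine sum_congr rfl fun l _ => ?_
  rcases Nat.eq_zero_or_pos (n - l) with h0 | h0
  · simp [h0]
  · obtain ⟨m, hm⟩ := Nat.exists_eq_succ_of_ne_zero h0.ne'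
    rw [hm, Nat.succ_sub_one, pow_succ]
    ring

lemma reverseBessel_succ (n : ℕ) (y : ℝ) :
    reverseBessel (n + 1) y =
      (2 * n + 1 + y) * reverseBessel n y - y * deriv (reverseBessel n) y := by
  rw [mul_deriv_reverseBessel]
  have split : ∀ l ∈ range (n + 1 + 1),
      ((n + 1 + l)! : ℝ) / ((l ! : ℝ) * ((n + 1 - l)! : ℝ) * 2 ^ l) * y ^ (n + 1 - l) =
        ((n + 1 - l : ℕ) : ℝ) * (((n + l)! : ℝ) / ((l ! : ℝ) * ((n + 1 - l)! : ℝ) * 2 ^ l)) *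
          y ^ (n + 1 - l) +
        2 * l * (((n + l)! : ℝ) / ((l ! : ℝ) * ((n + 1 - l)! : ℝ) * 2 ^ l)) *
          y ^ (n + 1 - l) := by
    intro l hl
    have hl' : l ≤ n + 1 := Nat.lt_succ_iff.mp (mem_range.mp hl)
    rw [show n + 1 + l = (n + l) + 1 by ring, Nat.factorial_succ, Nat.cast_sub hl']
    push_cast
    ring
  rw [reverseBessel, sum_congr rfl split, sum_add_distrib, sum_range_succ,
    sum_range_succ' (fun l => 2 * (l : ℝ) * _ * _), reverseBessel, mul_sum]
  simp only [Nat.sub_self, Nat.cast_zero, zero_mul, mul_zero, add_zero]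
  rw [← sum_add_distrib, ← sum_sub_distrib]
  refine sum_congr rfl fun l hl => ?_
  have hl' : l ≤ n := Nat.lt_succ_iff.mp (mem_range.mp hl)
  obtain ⟨m, rfl⟩ := Nat.exists_eq_add_of_le hl'
  rw [show l + m + 1 - l = m + 1 by omega, show l + m + 1 - (l + 1) = m by omega,
    show l + m - l = m by omega, show l + m + (l + 1) = (l + m + l) + 1 by ring]
  simp only [Nat.factorial_succ, pow_succ]
  push_cast
  field_simp
  ring

lemma integrable_inv_sq_add_sq_pow {a : ℝ} (ha : 0 < a) (n : ℕ) :
    Integrable fun k : ℝ => ((a ^ 2 + k ^ 2) ^ (n + 1))⁻¹ := by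
  have h1 : Integrable fun k : ℝ => (a ^ 2 + k ^ 2)⁻¹ := by
    convert (integrable_inv_one_add_sq.comp_div ha.ne').const_mul (a ^ 2)⁻¹ using 2 with k
    field_simp
  refine (h1.const_mul ((a ^ 2) ^ n)⁻¹).mono'
    (by fun_prop) (ae_of_all _ fun k => ?_)
  rw [Real.norm_of_nonneg (by positivity), ← mul_inv, pow_succ]
  gcongr
  nlinarith [sq_nonneg k]

lemma norm_exp_neg_I_mul_mul (k x : ℝ) : ‖Complex.exp (-Complex.I * k * x)‖ = 1 := by
  rw [Complex.norm_exp]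
  simp

lemma norm_exp_div_pow {γ : ℝ} (n : ℕ) (k x : ℝ) :
    ‖Complex.exp (-Complex.I * k * x) / ((γ : ℂ) ^ 2 + (k : ℂ) ^ 2) ^ n‖ =
      ((γ ^ 2 + k ^ 2) ^ n)⁻¹ := by
  rw [norm_div, norm_exp_neg_I_mul_mul, one_div]
  have : ((γ : ℂ) ^ 2 + (k : ℂ) ^ 2) = ((γ ^ 2 + k ^ 2 : ℝ) : ℂ) := by push_cast; rfl
  rw [this, norm_pow, Complex.norm_real, Real.norm_of_nonneg (by positivity)]

lemma aestronglyMeasurable_exp_div_pow (γ : ℝ) (n : ℕ) (x : ℝ) :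
    AEStronglyMeasurable fun k : ℝ =>
      Complex.exp (-Complex.I * k * x) / ((γ : ℂ) ^ 2 + (k : ℂ) ^ 2) ^ n :=
  Measurable.aestronglyMeasurable (by fun_prop)

lemma integrable_exp_div_pow {γ : ℝ} (hγ : 0 < γ) (n : ℕ) (x : ℝ) :
    Integrable fun k : ℝ =>
      Complex.exp (-Complex.I * k * x) / ((γ : ℂ) ^ 2 + (k : ℂ) ^ 2) ^ (n + 1) :=
  (integrable_inv_sq_add_sq_pow hγ n).mono' (aestronglyMeasurable_exp_div_pow γ _ x)
    (ae_of_all _ fun k => (norm_exp_div_pow _ k x).le)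

lemma hasDerivAt_integral_exp_div_pow {γ : ℝ} (hγ : 0 < γ) (n : ℕ) (x : ℝ) :
    HasDerivAt (fun g : ℝ => ∫ k : ℝ,
        Complex.exp (-Complex.I * k * x) / ((g : ℂ) ^ 2 + (k : ℂ) ^ 2) ^ (n + 1))
      (-(2 * (n + 1) * γ : ℂ) * ∫ k : ℝ,
        Complex.exp (-Complex.I * k * x) / ((γ : ℂ) ^ 2 + (k : ℂ) ^ 2) ^ (n + 2)) γ := by
  rw [← integral_const_mul]
  refine (hasDerivAt_integral_of_dominated_loc_of_deriv_le
    (s := Set.Ioo (γ / 2) (2 * γ))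
    (F' := fun g k => -(2 * (n + 1) * g : ℂ) *
      (Complex.exp (-Complex.I * k * x) / ((g : ℂ) ^ 2 + (k : ℂ) ^ 2) ^ (n + 2)))
    (bound := fun k => (2 * (n + 1) * (2 * γ)) * (((γ / 2) ^ 2 + k ^ 2) ^ (n + 1 + 1))⁻¹)
    (Ioo_mem_nhds (by linarith) (by linarith))
    (Filter.Eventually.of_forall fun g => aestronglyMeasurable_exp_div_pow g _ x)
    (integrable_exp_div_pow hγ n x)
    ((aestronglyMeasurable_exp_div_pow γ _ x).const_mul _)
    (ae_of_all _ fun k g hg => ?_)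
    ((integrable_inv_sq_add_sq_pow (half_pos hγ) (n + 1)).const_mul _)
    (ae_of_all _ fun k g hg => ?_)).2
  · have hg0 : 0 < g := by linarith [hg.1]
    have : (-(2 * (n + 1) * g : ℂ)) = ((-(2 * (n + 1) * g) : ℝ) : ℂ) := by push_cast; rfl
    rw [norm_mul, norm_exp_div_pow, this, Complex.norm_real, norm_neg,
      Real.norm_of_nonneg (by positivity)]
    gcongr
    · exact hg.2.le
    · exact hg.1.le
  · have hg0 : 0 < g := by linarith [hg.1]
    have hne : (g : ℂ) ^ 2 + (k : ℂ) ^ 2 ≠ 0 := by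
      have : (0 : ℝ) < g ^ 2 + k ^ 2 := by positivity
      exact_mod_cast this.ne'
    have h1 : HasDerivAt (fun t : ℝ => ((t : ℂ) ^ 2 + (k : ℂ) ^ 2) ^ (n + 1))
        (((n + 1 : ℕ) : ℂ) * ((g : ℂ) ^ 2 + (k : ℂ) ^ 2) ^ n * (2 * g)) g := by
      have h2 := ((((hasDerivAt_id (g : ℂ)).pow 2).add_const ((k : ℂ) ^ 2)).pow
        (n + 1)).comp_ofReal
      simpa using! h2
    refine ((hasDerivAt_const g (Complex.exp (-Complex.I * k * x))).fun_div h1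
      (pow_ne_zero _ hne)).congr_deriv ?_
    push_cast
    field_simp
    ring

lemma integrable_exp_neg_mul_abs {γ : ℝ} (hγ : 0 < γ) :
    Integrable fun v : ℝ => ((Real.exp (-γ * |v|) : ℝ) : ℂ) := by
  refine Integrable.ofReal (f := fun v : ℝ => Real.exp (-γ * |v|)) ?_
  rw [← integrableOn_univ, ← Set.Iic_union_Ioi (a := (0 : ℝ)), integrableOn_union]
  constructor
  · refine (integrableOn_exp_mul_Iic hγ 0).congr_fun (fun v hv => ?_) measurableSet_Iic
    simp [abs_of_nonpos (Set.mem_Iic.mp hv)]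
  · refine (integrableOn_exp_mul_Ioi (neg_neg_of_pos hγ) 0).congr_fun (fun v hv => ?_)
      measurableSet_Ioi
    simp [abs_of_pos (Set.mem_Ioi.mp hv)]

lemma fourier_exp_neg_mul_abs {γ : ℝ} (hγ : 0 < γ) (w : ℝ) :
    𝓕 (fun v : ℝ => ((Real.exp (-γ * |v|) : ℝ) : ℂ)) w =
      2 * γ / ((γ : ℂ) ^ 2 + ((2 * Real.pi * w : ℝ) : ℂ) ^ 2) := by
  rw [Real.fourier_real_eq_integral_exp_smul]
  set b : ℝ := 2 * Real.pi * w with hb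
  have hp : 0 < ((γ : ℂ) - b * Complex.I).re := by simpa using hγ
  have hm : ((-γ : ℂ) - b * Complex.I).re < 0 := by simpa using hγ
  have e1 : Set.EqOn (fun v : ℝ => Complex.exp (((γ : ℂ) - b * Complex.I) * v))
      (fun v : ℝ => Complex.exp (↑(-2 * Real.pi * v * w) * Complex.I) •
        ((Real.exp (-γ * |v|) : ℝ) : ℂ)) (Set.Iic 0) := by
    intro v hv
    simp only [abs_of_nonpos (Set.mem_Iic.mp hv), smul_eq_mul, Complex.ofReal_exp,
      ← Complex.exp_add, hb]
    congr 1
    push_cast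
    ring
  have e2 : Set.EqOn (fun v : ℝ => Complex.exp (((-γ : ℂ) - b * Complex.I) * v))
      (fun v : ℝ => Complex.exp (↑(-2 * Real.pi * v * w) * Complex.I) •
        ((Real.exp (-γ * |v|) : ℝ) : ℂ)) (Set.Ioi 0) := by
    intro v hv
    simp only [abs_of_pos (Set.mem_Ioi.mp hv), smul_eq_mul, Complex.ofReal_exp,
      ← Complex.exp_add, hb]
    congr 1
    push_cast
    ring
  rw [← intervalIntegral.integral_Iic_add_Ioi
      ((integrableOn_exp_mul_complex_Iic hp 0).congr_fun e1 measurableSet_Iic)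
      ((integrableOn_exp_mul_complex_Ioi hm 0).congr_fun e2 measurableSet_Ioi),
    ← setIntegral_congr_fun measurableSet_Iic e1, ← setIntegral_congr_fun measurableSet_Ioi e2,
    integral_exp_mul_complex_Iic hp, integral_exp_mul_complex_Ioi hm]
  have n1 : (γ : ℂ) - b * Complex.I ≠ 0 := fun h => by simp [h] at hp
  have n2 : (-γ : ℂ) - b * Complex.I ≠ 0 := fun h => by simp [h] at hm
  have n3 : (γ : ℂ) ^ 2 + (b : ℂ) ^ 2 = -(((γ : ℂ) - b * Complex.I) * (-γ - b * Complex.I)) := by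
    linear_combination (b : ℂ) ^ 2 * Complex.I_sq
  rw [n3]
  simp only [Complex.ofReal_zero, mul_zero, Complex.exp_zero]
  field_simp
  ring

lemma integral_exp_div_sq_add_sq {γ : ℝ} (hγ : 0 < γ) (x : ℝ) :
    ∫ k : ℝ, Complex.exp (-Complex.I * k * x) / ((γ : ℂ) ^ 2 + (k : ℂ) ^ 2) =
      ((Real.pi / γ * Real.exp (-γ * |x|) : ℝ) : ℂ) := by
  set f : ℝ → ℂ := fun v => ((Real.exp (-γ * |v|) : ℝ) : ℂ)
  have hF : 𝓕 f = fun w : ℝ => 2 * (γ : ℂ) / ((γ : ℂ) ^ 2 + ((2 * Real.pi * w : ℝ) : ℂ) ^ 2) :=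
    funext (fourier_exp_neg_mul_abs hγ)
  have hinv : 𝓕⁻ f = 𝓕 f := by
    ext w
    rw [Real.fourierInv_eq_fourier_neg, hF]
    simp
  have hFint : Integrable (𝓕 f) := by
    rw [hF]
    have h := ((integrable_exp_div_pow hγ 0 0).const_mul (2 * (γ : ℂ))).comp_mul_left'
      (R := 2 * Real.pi) (by positivity)
    simpa [div_eq_mul_inv] using h
  have hcont : Continuous f := by fun_prop
  have key := congrFun (hcont.fourier_fourierInv_eq (integrable_exp_neg_mul_abs hγ) hFint) x
  rw [hinv, hF, Real.fourier_real_eq_integral_exp_smul] at key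
  have hsub := Measure.integral_comp_mul_left (fun k : ℝ => 2 * (γ : ℂ) *
    (Complex.exp (-Complex.I * k * x) / ((γ : ℂ) ^ 2 + (k : ℂ) ^ 2))) (2 * Real.pi)
  rw [abs_of_pos (by positivity)] at hsub
  have hkey : ∫ v : ℝ, 2 * (γ : ℂ) * (Complex.exp (-Complex.I * (2 * Real.pi * v : ℝ) * x) /
      ((γ : ℂ) ^ 2 + ((2 * Real.pi * v : ℝ) : ℂ) ^ 2)) = f x := by
    rw [← key]
    congr 1 with v
    rw [smul_eq_mul, show (-Complex.I * (2 * Real.pi * v : ℝ) * x : ℂ) =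
      ↑(-2 * Real.pi * v * x) * Complex.I by push_cast; ring]
    ring
  rw [hkey, integral_const_mul, Complex.real_smul] at hsub
  have hγ' : (γ : ℂ) ≠ 0 := by exact_mod_cast hγ.ne'
  have hpi : (Real.pi : ℂ) ≠ 0 := by exact_mod_cast Real.pi_ne_zero
  rw [Complex.ofReal_mul, show ((Real.exp (-γ * |x|) : ℝ) : ℂ) = f x from rfl, hsub]
  generalize (∫ k : ℝ, Complex.exp (-Complex.I * k * x) / ((γ : ℂ) ^ 2 + (k : ℂ) ^ 2)) = J
  push_cast
  field_simp

lemma hasDerivAt_exp_mul_reverseBessel {γ : ℝ} (hγ : 0 < γ) (n : ℕ) (x : ℝ) :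
    HasDerivAt (fun g : ℝ => Real.pi / (g ^ (2 * n + 1) * 2 ^ n * n !) * Real.exp (-g * |x|) *
        reverseBessel n (g * |x|))
      (-(2 * (n + 1) * γ) * (Real.pi / (γ ^ (2 * n + 3) * 2 ^ (n + 1) * (n + 1)!) *
        Real.exp (-γ * |x|) * reverseBessel (n + 1) (γ * |x|))) γ := by
  have hmul : HasDerivAt (fun g : ℝ => g * |x|) |x| γ := by
    simpa using (hasDerivAt_id γ).mul_const |x|
  have h1 : HasDerivAt (fun g : ℝ => reverseBessel n (g * |x|))
      (deriv (reverseBessel n) (γ * |x|) * |x|) γ :=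
    ((differentiable_reverseBessel n _).hasDerivAt).comp γ hmul
  have h2 : HasDerivAt (fun g : ℝ => Real.exp (-g * |x|)) (Real.exp (-γ * |x|) * (-|x|)) γ := by
    simpa using hmul.neg.exp
  have h3 : HasDerivAt (fun g : ℝ => g ^ (2 * n + 1) * 2 ^ n * (n ! : ℝ))
      (((2 * n + 1 : ℕ) : ℝ) * γ ^ (2 * n) * 2 ^ n * n !) γ :=
    ((hasDerivAt_pow (2 * n + 1) γ).mul_const _).mul_const _
  refine ((((hasDerivAt_const γ Real.pi).fun_div h3 (by positivity)).fun_mul h2).fun_mul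
    h1).congr_deriv ?_
  rw [reverseBessel_succ, Nat.factorial_succ]
  push_cast
  field_simp
  ring

lemma integral_exp_div_pow_succ (n : ℕ) {γ : ℝ} (hγ : 0 < γ) (x : ℝ) :
    ∫ k : ℝ, Complex.exp (-Complex.I * k * x) / ((γ : ℂ) ^ 2 + (k : ℂ) ^ 2) ^ (n + 1) =
      ((Real.pi / (γ ^ (2 * n + 1) * 2 ^ n * n !) * Real.exp (-γ * |x|) *
        reverseBessel n (γ * |x|) : ℝ) : ℂ) := by
  induction n generalizing γ with
  | zero => simpa [reverseBessel] using integral_exp_div_sq_add_sq hγ x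
  | succ n ih =>
    have h := (hasDerivAt_integral_exp_div_pow hγ n x).unique
      ((hasDerivAt_exp_mul_reverseBessel hγ n x).ofReal_comp.congr_of_eventuallyEq
        ((lt_mem_nhds hγ).mono fun g hg => ih hg))
    have hne : (-(2 * (n + 1) * γ) : ℂ) ≠ 0 := by
      have : (2 * (n + 1) * γ : ℝ) ≠ 0 := by positivity
      exact neg_ne_zero.mpr (by exact_mod_cast this)
    refine mul_left_cancel₀ hne (h.trans ?_)
    rw [Complex.ofReal_mul]
    push_cast
    rfl

/-- For integer `M ≥ 1`, `γ > 0` and real `x`,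
`∫_ℝ e^{-ikx}/(γ²+k²)^M dk
   = (π/(γ^{2M-1} 2^{M-1} (M-1)!)) · e^{-γ|x|} · ∑_{l=0}^{M-1} ((M-1+l)!/(l!(M-1-l)! 2^l)) |γx|^{M-1-l}`. -/
theorem fourier_integral_inv_pow_quadratic (M : ℕ) (hM : 1 ≤ M) (γ : ℝ) (hγ : 0 < γ) (x : ℝ) :
    (∫ k : ℝ, Complex.exp (-Complex.I * k * x) / ((γ : ℂ) ^ 2 + (k : ℂ) ^ 2) ^ M)
      = ((Real.pi / (γ ^ (2 * M - 1) * 2 ^ (M - 1) * (Nat.factorial (M - 1))) *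
          Real.exp (-γ * |x|) *
          ∑ l ∈ Finset.range M,
            ((Nat.factorial (M - 1 + l) : ℝ) /
              ((Nat.factorial l : ℝ) * (Nat.factorial (M - 1 - l) : ℝ) * 2 ^ l)) *
            |γ * x| ^ (M - 1 - l) : ℝ) : ℂ) := by
  obtain ⟨n, rfl⟩ := Nat.exists_eq_add_of_le' hM
  rw [integral_exp_div_pow_succ n hγ x, abs_mul, abs_of_pos hγ, Nat.add_sub_cancel,
    show 2 * (n + 1) - 1 = 2 * n + 1 by omega]
  rfl
end

section
/- Let N, M ≥ 1 be integers, a > 0, let A be an N×N Hermitian complex matrix, and let X be an M×M Hermitian complex matrix with eigenvalues x_1, …, x_M (listed with multiplicity). Then ∫ exp(-a·Tr(W†W)) · exp(-i·Tr(X W† A W)) dW = ( ∏_{c=1}^{M} det(1_N + (i x_c / a) A) )^{-1} · ∫ exp(-a·Tr(W†W)) dW, where the integrals are over all N×M complex matrices W with respect to Lebesgue measure, W† is the conjugate transpose, and 1_N is the N×N identity matrix. -/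
open MeasureTheory Matrix

theorem integral_comp_linearEquiv {E : Type*} [NormedAddCommGroup E] [NormedSpace ℝ E]
    [MeasurableSpace E] [BorelSpace E] [FiniteDimensional ℝ E] (μ : Measure E) [μ.IsAddHaarMeasure]
    (L : E ≃ₗ[ℝ] E) (f : E → ℂ) :
    ∫ x, f (L x) ∂μ = |(LinearMap.det (L : E →ₗ[ℝ] E))⁻¹| • ∫ x, f x ∂μ := by
  have hemb := L.toContinuousLinearEquiv.toHomeomorph.measurableEmbedding
  have hmap := Measure.map_linearMap_addHaar_eq_smul_addHaar μ (LinearEquiv.isUnit_det' L).ne_zero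
  have h := hemb.integral_map (μ := μ) f
  have hmap' : Measure.map (⇑L.toContinuousLinearEquiv.toHomeomorph) μ = _ := hmap
  rw [hmap', integral_smul_measure, ENNReal.toReal_ofReal (abs_nonneg _)] at h
  exact h.symm

/-- The real-linear automorphism `Z ↦ U * Z * Vᴴ` of the space of `n × m` complex matrices. -/
def unitaryConjEquiv {n m : Type*} [Fintype n] [Fintype m] [DecidableEq n] [DecidableEq m]
    (U : unitaryGroup n ℂ) (V : unitaryGroup m ℂ) : (n → m → ℂ) ≃ₗ[ℝ] (n → m → ℂ) where
  toFun Z := (U : Matrix n n ℂ) * of Z * star (V : Matrix m m ℂ)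
  invFun Z := star (U : Matrix n n ℂ) * of Z * (V : Matrix m m ℂ)
  map_add' Y Z := by
    change (U : Matrix n n ℂ) * (of Y + of Z) * star (V : Matrix m m ℂ) = _
    rw [Matrix.mul_add, Matrix.add_mul]
    rfl
  map_smul' r Z := by
    change (U : Matrix n n ℂ) * (r • of Z) * star (V : Matrix m m ℂ) = _
    rw [Matrix.mul_smul, Matrix.smul_mul]
    rfl
  left_inv Z := by
    change star (U : Matrix n n ℂ) * ((U : Matrix n n ℂ) * of Z * star (V : Matrix m m ℂ)) *
      (V : Matrix m m ℂ) = of Z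
    rw [Matrix.mul_assoc, Matrix.mul_assoc, Matrix.mul_assoc, Unitary.star_mul_self_of_mem V.2,
      Matrix.mul_one, ← Matrix.mul_assoc, Unitary.star_mul_self_of_mem U.2, Matrix.one_mul]
  right_inv Z := by
    change (U : Matrix n n ℂ) * (star (U : Matrix n n ℂ) * of Z * (V : Matrix m m ℂ)) *
      star (V : Matrix m m ℂ) = of Z
    rw [Matrix.mul_assoc, Matrix.mul_assoc, Matrix.mul_assoc, Unitary.mul_star_self_of_mem V.2,
      Matrix.mul_one, ← Matrix.mul_assoc, Unitary.mul_star_self_of_mem U.2, Matrix.one_mul]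

theorem of_unitaryConjEquiv {n m : Type*} [Fintype n] [Fintype m] [DecidableEq n] [DecidableEq m]
    (U : unitaryGroup n ℂ) (V : unitaryGroup m ℂ) (Z : n → m → ℂ) :
    of (unitaryConjEquiv U V Z) = (U : Matrix n n ℂ) * of Z * star (V : Matrix m m ℂ) :=
  rfl

/-- The trace of `X * Wᴴ * A * W` in coordinates where both `X` and `A` are diagonal. -/
theorem trace_unitaryConj {n m : Type*} [Fintype n] [Fintype m] [DecidableEq n] [DecidableEq m]
    (U : unitaryGroup n ℂ) (V : unitaryGroup m ℂ) (α : n → ℂ) (ξ : m → ℂ) (Z : n → m → ℂ) :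
    trace (((V : Matrix m m ℂ) * diagonal ξ * star (V : Matrix m m ℂ)) *
      (of (unitaryConjEquiv U V Z))ᴴ *
      ((U : Matrix n n ℂ) * diagonal α * star (U : Matrix n n ℂ)) * of (unitaryConjEquiv U V Z)) =
      ∑ i, ∑ c, ξ c * α i * (‖Z i c‖ : ℂ) ^ 2 := by
  have hU := Unitary.star_mul_self_of_mem U.2
  have hV := Unitary.star_mul_self_of_mem V.2
  rw [of_unitaryConjEquiv]
  have h : ((V : Matrix m m ℂ) * diagonal ξ * star (V : Matrix m m ℂ)) *
      ((U : Matrix n n ℂ) * of Z * star (V : Matrix m m ℂ))ᴴ *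
      ((U : Matrix n n ℂ) * diagonal α * star (U : Matrix n n ℂ)) *
      ((U : Matrix n n ℂ) * of Z * star (V : Matrix m m ℂ)) =
      (V : Matrix m m ℂ) * diagonal ξ * (star (V : Matrix m m ℂ) * (V : Matrix m m ℂ)) * (of Z)ᴴ *
        (star (U : Matrix n n ℂ) * (U : Matrix n n ℂ)) * diagonal α *
        (star (U : Matrix n n ℂ) * (U : Matrix n n ℂ)) * of Z *
        star (V : Matrix m m ℂ) := by
    simp only [conjTranspose_mul, star_eq_conjTranspose, conjTranspose_conjTranspose,
      Matrix.mul_assoc]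
  rw [h, hU, hV, trace_mul_comm]
  simp only [← Matrix.mul_assoc, hV, Matrix.one_mul, Matrix.mul_one]
  rw [Finset.sum_comm]
  simp only [trace, diag_apply]
  refine Finset.sum_congr rfl fun c _ => ?_
  rw [Matrix.mul_apply]
  refine Finset.sum_congr rfl fun i _ => ?_
  rw [mul_diagonal, diagonal_mul, conjTranspose_apply, of_apply, ← Complex.conj_mul',
    RCLike.star_def]
  ring

theorem integral_cexp_neg_sum_sum_mul_norm_sq {n m : Type*} [Fintype n] [Fintype m]
    (b : n → m → ℂ) (hb : ∀ i c, 0 < (b i c).re) :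
    ∫ Z : n → m → ℂ, Complex.exp (-∑ i, ∑ c, b i c * (‖Z i c‖ : ℂ) ^ 2) =
      ∏ i, ∏ c, (Real.pi / b i c : ℂ) := by
  have h (Z : n → m → ℂ) : Complex.exp (-∑ i, ∑ c, b i c * (‖Z i c‖ : ℂ) ^ 2) =
      ∏ i, ∏ c, Complex.exp (-b i c * (‖Z i c‖ : ℂ) ^ 2) := by
    simp_rw [← Complex.exp_sum, ← Finset.sum_neg_distrib, neg_mul]
  simp_rw [h]
  rw [integral_fintype_prod_volume_eq_prod
    (fun i (z : m → ℂ) => ∏ c, Complex.exp (-b i c * (‖z c‖ : ℂ) ^ 2))]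
  refine Finset.prod_congr rfl fun i _ => ?_
  rw [integral_fintype_prod_volume_eq_prod
    (fun c (z : ℂ) => Complex.exp (-b i c * (‖z‖ : ℂ) ^ 2))]
  refine Finset.prod_congr rfl fun c _ => ?_
  rw [GaussianFourier.integral_cexp_neg_mul_sq_norm (hb i c)]
  simp

theorem integral_cexp_trace_unitaryConj {n m : Type*} [Fintype n] [Fintype m] [DecidableEq n]
    [DecidableEq m] (U : unitaryGroup n ℂ) (V : unitaryGroup m ℂ) (a : ℝ) (ha : 0 < a)
    (α : n → ℝ) (ξ : m → ℝ) :
    |(LinearMap.det (unitaryConjEquiv U V : (n → m → ℂ) →ₗ[ℝ] (n → m → ℂ)))⁻¹| •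
      ∫ W : n → m → ℂ, Complex.exp (-(a : ℂ) * trace ((of W)ᴴ * of W) - Complex.I *
        trace (((V : Matrix m m ℂ) * diagonal (fun c => (ξ c : ℂ)) * star (V : Matrix m m ℂ)) * (of W)ᴴ *
          ((U : Matrix n n ℂ) * diagonal (fun i => (α i : ℂ)) * star (U : Matrix n n ℂ)) * of W)) =
      ∏ i, ∏ c, (Real.pi / (a + Complex.I * (ξ c * α i)) : ℂ) := by
  have hHaar : (volume : Measure (n → m → ℂ)).IsAddHaarMeasure := Measure.pi.isAddHaarMeasure _
  rw [← integral_comp_linearEquiv volume (unitaryConjEquiv U V)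
    (fun W : n → m → ℂ => Complex.exp (-(a : ℂ) * trace ((of W)ᴴ * of W) - Complex.I *
        trace (((V : Matrix m m ℂ) * diagonal (fun c => (ξ c : ℂ)) * star (V : Matrix m m ℂ)) * (of W)ᴴ *
          ((U : Matrix n n ℂ) * diagonal (fun i => (α i : ℂ)) * star (U : Matrix n n ℂ)) * of W))),
    ← integral_cexp_neg_sum_sum_mul_norm_sq]
  · congr 1
    funext Z
    have h1 := trace_unitaryConj U V (fun _ => 1) (fun _ => 1) Z
    simp only [diagonal_one, Matrix.mul_one, Unitary.mul_star_self_of_mem U.2,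
      Unitary.mul_star_self_of_mem V.2, Matrix.one_mul,
      one_mul] at h1
    rw [h1, trace_unitaryConj]
    congr 1
    simp only [add_mul, Finset.sum_add_distrib, Finset.mul_sum, mul_assoc, neg_mul,
      Finset.sum_neg_distrib]
    ring
  · intro i c
    simpa [← Complex.ofReal_mul] using ha

theorem Matrix.IsHermitian.det_one_add_smul {n : Type*} [Fintype n] [DecidableEq n]
    {A : Matrix n n ℂ} (hA : A.IsHermitian) (s : ℂ) :
    det (1 + s • A) = ∏ i, (1 + s * hA.eigenvalues i) := by
  have hU := Unitary.mul_star_self_of_mem hA.eigenvectorUnitary.2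
  have h : 1 + s • A = hA.eigenvectorUnitary *
      diagonal (fun i => 1 + s * (hA.eigenvalues i : ℂ)) *
      star (hA.eigenvectorUnitary : Matrix n n ℂ) := by
    have hd : diagonal (fun i => 1 + s * (hA.eigenvalues i : ℂ)) =
        1 + s • diagonal (RCLike.ofReal ∘ hA.eigenvalues) := by
      ext i j
      by_cases hij : i = j <;> simp [hij, diagonal]
    conv_lhs => rw [hA.spectral_theorem, Unitary.conjStarAlgAut_apply]
    rw [hd, Matrix.mul_add, Matrix.add_mul, Matrix.mul_one, hU, Matrix.mul_smul, Matrix.smul_mul]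
  rw [h, det_mul_right_comm, hU, Matrix.one_mul, det_diagonal]

open MeasureTheory Matrix

/-- For `N, M ≥ 1`, `a > 0`, `A` an `N×N` Hermitian matrix and `X` an
`M×M` Hermitian matrix with eigenvalues `x_1, …, x_M`,
`∫ exp(-a·Tr(W†W)) · exp(-i·Tr(X W† A W)) dW
  = (∏_c det(1_N + (i x_c/a) A))⁻¹ · ∫ exp(-a·Tr(W†W)) dW`,
the integrals being over all `N×M` complex matrices `W` with Lebesgue measure. -/
theorem gaussian_matrix_integral (N M : ℕ) (hN : 1 ≤ N) (hM : 1 ≤ M) (a : ℝ) (ha : 0 < a)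
    (A : Matrix (Fin N) (Fin N) ℂ) (hA : A.IsHermitian)
    (X : Matrix (Fin M) (Fin M) ℂ) (hX : X.IsHermitian) :
    (∫ W : Fin N → Fin M → ℂ,
        Complex.exp (-(a : ℂ) * Matrix.trace ((Matrix.of W)ᴴ * Matrix.of W)
          - Complex.I * Matrix.trace (X * (Matrix.of W)ᴴ * A * Matrix.of W)))
      = (∏ c : Fin M,
          Matrix.det ((1 : Matrix (Fin N) (Fin N) ℂ)
            + ((Complex.I * (hX.eigenvalues c : ℂ) / (a : ℂ)) • A)))⁻¹ *
        ∫ W : Fin N → Fin M → ℂ,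
          Complex.exp (-(a : ℂ) * Matrix.trace ((Matrix.of W)ᴴ * Matrix.of W)) := by
  set U := hA.eigenvectorUnitary
  set V := hX.eigenvectorUnitary
  have hk : |(LinearMap.det (unitaryConjEquiv U V :
      (Fin N → Fin M → ℂ) →ₗ[ℝ] (Fin N → Fin M → ℂ)))⁻¹| ≠ 0 :=
    abs_ne_zero.mpr (inv_ne_zero (LinearEquiv.isUnit_det' _).ne_zero)
  have h₁ := integral_cexp_trace_unitaryConj U V a ha hA.eigenvalues hX.eigenvalues
  have h₀ := integral_cexp_trace_unitaryConj U V a ha (0 : Fin N → ℝ) (0 : Fin M → ℝ)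
  have hAU : (U : Matrix (Fin N) (Fin N) ℂ) * diagonal (fun i => (hA.eigenvalues i : ℂ)) *
      star (U : Matrix (Fin N) (Fin N) ℂ) = A := by
    conv_rhs => rw [hA.spectral_theorem, Unitary.conjStarAlgAut_apply]
    rfl
  have hXV : (V : Matrix (Fin M) (Fin M) ℂ) * diagonal (fun c => (hX.eigenvalues c : ℂ)) *
      star (V : Matrix (Fin M) (Fin M) ℂ) = X := by
    conv_rhs => rw [hX.spectral_theorem, Unitary.conjStarAlgAut_apply]
    rfl
  rw [hAU, hXV] at h₁
  simp only [Pi.zero_apply, Complex.ofReal_zero, diagonal_zero, Matrix.mul_zero, Matrix.zero_mul,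
    trace_zero, mul_zero, sub_zero, add_zero] at h₀
  apply smul_right_injective ℂ hk
  simp only
  rw [h₁, ← mul_smul_comm, h₀, Finset.prod_comm, Finset.prod_comm (s := Finset.univ (α := Fin N)),
    ← Finset.prod_inv_distrib, ← Finset.prod_mul_distrib]
  refine Finset.prod_congr rfl fun c _ => ?_
  rw [hA.det_one_add_smul, ← Finset.prod_inv_distrib, ← Finset.prod_mul_distrib]
  refine Finset.prod_congr rfl fun i _ => ?_
  have ha' : (a : ℂ) ≠ 0 := Complex.ofReal_ne_zero.mpr ha.ne'
  have h : (a : ℂ) + Complex.I * (hX.eigenvalues c * hA.eigenvalues i) =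
      a * (1 + Complex.I * hX.eigenvalues c / a * hA.eigenvalues i) := by
    field_simp
  rw [h, div_mul_eq_div_div, div_eq_mul_inv _ (1 + _), mul_comm]
end

section
/- Let N, M ≥ 1 be integers, γ > 0, ρ > 0, let H be an N×N Hermitian complex matrix and let E be a real number that is not an eigenvalue of H. Let X be an M×M Hermitian complex matrix with eigenvalues x_1, …, x_M (listed with multiplicity). Then the average over N×M complex matrices W with Gaussian probability density proportional to exp(-(N/γ)·Tr(W†W)) satisfies: E_W[ exp( -(i/(πρ)) · Tr( X W† (E·1_N - H)^{-1} W ) ) ] = ∏_{c=1}^{M} det(E·1_N - H) / det( (E + iγx_c/(πNρ))·1_N - H ). -/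
open MeasureTheory Matrix

/-- A Hermitian complex matrix is unitarily diagonalised by its eigenvalues. -/
theorem exists_unitary_diagonalization {n : ℕ} {A : Matrix (Fin n) (Fin n) ℂ}
    (hA : A.IsHermitian) :
    ∃ U : Matrix (Fin n) (Fin n) ℂ, Uᴴ * U = 1 ∧ U * Uᴴ = 1 ∧
      A = U * diagonal (fun i => (hA.eigenvalues i : ℂ)) * Uᴴ := by
  refine ⟨hA.eigenvectorUnitary, ?_, ?_, ?_⟩
  · exact Unitary.coe_star_mul_self hA.eigenvectorUnitary
  · exact Unitary.coe_mul_star_self hA.eigenvectorUnitary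
  · have h := hA.spectral_theorem
    rw [Unitary.conjStarAlgAut_apply] at h
    exact h

theorem smul_one_sub_conj_diagonal {n : ℕ} {U : Matrix (Fin n) (Fin n) ℂ}
    (hU : U * Uᴴ = 1) (d : Fin n → ℂ) (z : ℂ) :
    z • (1 : Matrix (Fin n) (Fin n) ℂ) - U * diagonal d * Uᴴ =
      U * diagonal (fun i => z - d i) * Uᴴ := by
  have h : diagonal (fun i => z - d i) = z • (1 : Matrix (Fin n) (Fin n) ℂ) - diagonal d := by
    rw [smul_one_eq_diagonal, diagonal_sub]
  rw [h, mul_sub, sub_mul, mul_smul_comm, mul_one, smul_mul_assoc, hU]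

theorem det_conj_diagonal {n : ℕ} {U : Matrix (Fin n) (Fin n) ℂ}
    (hU : U * Uᴴ = 1) (d : Fin n → ℂ) :
    (U * diagonal d * Uᴴ).det = ∏ i, d i := by
  rw [det_mul_right_comm, hU, one_mul, det_diagonal]

theorem inv_conj_diagonal {n : ℕ} {U : Matrix (Fin n) (Fin n) ℂ}
    (hU : U * Uᴴ = 1) (hU' : Uᴴ * U = 1) {d : Fin n → ℂ} (hd : ∀ i, d i ≠ 0) :
    (U * diagonal d * Uᴴ)⁻¹ = U * diagonal (fun i => (d i)⁻¹) * Uᴴ := by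
  apply inv_eq_right_inv
  calc U * diagonal d * Uᴴ * (U * diagonal (fun i => (d i)⁻¹) * Uᴴ)
      = U * (diagonal d * (Uᴴ * U) * diagonal (fun i => (d i)⁻¹)) * Uᴴ := by
        simp only [mul_assoc]
    _ = 1 := by
        have h : (fun i => d i * (d i)⁻¹) = fun _ => (1 : ℂ) :=
          funext fun i => mul_inv_cancel₀ (hd i)
        rw [hU', mul_one, diagonal_mul_diagonal, h, diagonal_one, mul_one, hU]

/-- Left and right multiplication by invertible matrices rescales all integrals over a matrix
space by one and the same factor. -/
theorem exists_integral_comp_mul_mul (n m : ℕ) {U U' : Matrix (Fin n) (Fin n) ℂ}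
    {V V' : Matrix (Fin m) (Fin m) ℂ} (hU : U * U' = 1) (hU' : U' * U = 1)
    (hV : V * V' = 1) (hV' : V' * V = 1) :
    ∃ r : ℝ, r ≠ 0 ∧ ∀ F : Matrix (Fin n) (Fin m) ℂ → ℂ,
      ∫ W : Fin n → Fin m → ℂ, F (U * Matrix.of W * V) =
        r • ∫ W : Fin n → Fin m → ℂ, F (Matrix.of W) := by
  let e : (Fin n → Fin m → ℂ) ≃ₗ[ℝ] (Fin n → Fin m → ℂ) :=
    { toFun := fun W => Matrix.of.symm (U * Matrix.of W * V)
      invFun := fun W => Matrix.of.symm (U' * Matrix.of W * V')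
      map_add' := fun W W' => by
        rw [← Matrix.of_add_of, Matrix.mul_add, Matrix.add_mul]; rfl
      map_smul' := fun c W => by
        rw [← Matrix.smul_of, Matrix.mul_smul, Matrix.smul_mul]; rfl
      left_inv := fun W => by
        change Matrix.of.symm (U' * (U * Matrix.of W * V) * V') = W
        have h : U' * (U * Matrix.of W * V) * V' = (U' * U) * Matrix.of W * (V * V') := by
          simp only [Matrix.mul_assoc]
        rw [h, hU', hV, Matrix.one_mul, Matrix.mul_one]; rfl
      right_inv := fun W => by
        change Matrix.of.symm (U * (U' * Matrix.of W * V') * V) = W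
        have h : U * (U' * Matrix.of W * V') * V = (U * U') * Matrix.of W * (V' * V) := by
          simp only [Matrix.mul_assoc]
        rw [h, hU, hV', Matrix.one_mul, Matrix.mul_one]; rfl }
  have hdet : LinearMap.det (e : (Fin n → Fin m → ℂ) →ₗ[ℝ] (Fin n → Fin m → ℂ)) ≠ 0 :=
    (LinearEquiv.isUnit_det' e).ne_zero
  refine ⟨|(LinearMap.det (e : (Fin n → Fin m → ℂ) →ₗ[ℝ] (Fin n → Fin m → ℂ)))⁻¹|,
    abs_ne_zero.mpr (inv_ne_zero hdet), fun F => ?_⟩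
  have : (volume : Measure (Fin m → ℂ)).IsAddHaarMeasure := inferInstance
  have : (volume : Measure (Fin n → Fin m → ℂ)).IsAddHaarMeasure :=
    Measure.pi.isAddHaarMeasure _
  have hmap := Measure.map_linearMap_addHaar_eq_smul_addHaar
    (volume : Measure (Fin n → Fin m → ℂ)) hdet
  have hint := integral_map_equiv (μ := (volume : Measure (Fin n → Fin m → ℂ)))
    e.toContinuousLinearEquiv.toHomeomorph.toMeasurableEquiv
    (fun W => F (Matrix.of W))
  have hcoe : (⇑e.toContinuousLinearEquiv.toHomeomorph.toMeasurableEquiv :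
      (Fin n → Fin m → ℂ) → (Fin n → Fin m → ℂ)) =
      ⇑(e : (Fin n → Fin m → ℂ) →ₗ[ℝ] (Fin n → Fin m → ℂ)) := rfl
  rw [hcoe, hmap, integral_smul_measure, ENNReal.toReal_ofReal (abs_nonneg _)] at hint
  exact hint.symm

theorem trace_conjTranspose_mul_self_eq_sum {n m : ℕ} (W : Matrix (Fin n) (Fin m) ℂ) :
    (Wᴴ * W).trace = ∑ i, ∑ j, (‖W i j‖ : ℂ) ^ 2 := by
  simp only [trace, diag_apply, mul_apply, conjTranspose_apply]
  rw [Finset.sum_comm]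
  refine Finset.sum_congr rfl fun i _ => Finset.sum_congr rfl fun j _ => ?_
  rw [← Complex.conj_mul']; rfl

theorem trace_diagonal_mul_conjTranspose_mul_diagonal_mul {n m : ℕ} (x : Fin m → ℂ)
    (g : Fin n → ℂ) (W : Matrix (Fin n) (Fin m) ℂ) :
    (diagonal x * Wᴴ * diagonal g * W).trace =
      ∑ i, ∑ j, x j * g i * (‖W i j‖ : ℂ) ^ 2 := by
  simp only [trace, diag_apply, mul_apply (M := diagonal x * Wᴴ * diagonal g), mul_diagonal,
    diagonal_mul, conjTranspose_apply]
  rw [Finset.sum_comm]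
  refine Finset.sum_congr rfl fun i _ => Finset.sum_congr rfl fun j _ => ?_
  rw [← Complex.conj_mul', starRingEnd_apply]; ring

theorem integral_cexp_neg_mul_norm_sq_complex {b : ℂ} (hb : 0 < b.re) :
    ∫ z : ℂ, Complex.exp (-b * (‖z‖ : ℂ) ^ 2) = Real.pi / b := by
  rw [GaussianFourier.integral_cexp_neg_mul_sq_norm hb, Complex.finrank_real_complex]
  norm_num

theorem integral_cexp_neg_sum_mul_norm_sq {n m : ℕ} {b : Fin n → Fin m → ℂ}
    (hb : ∀ i j, 0 < (b i j).re) :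
    ∫ W : Fin n → Fin m → ℂ, Complex.exp (∑ i, ∑ j, -b i j * (‖W i j‖ : ℂ) ^ 2) =
      ∏ i, ∏ j, (Real.pi / b i j : ℂ) := by
  simp only [Complex.exp_sum]
  rw [integral_fintype_prod_volume_eq_prod
    (fun i (w : Fin m → ℂ) => ∏ j, Complex.exp (-b i j * (‖w j‖ : ℂ) ^ 2))]
  refine Finset.prod_congr rfl fun i _ => ?_
  rw [integral_fintype_prod_volume_eq_prod
    (fun j (z : ℂ) => Complex.exp (-b i j * (‖z‖ : ℂ) ^ 2))]
  exact Finset.prod_congr rfl fun j _ => integral_cexp_neg_mul_norm_sq_complex (hb i j)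

/-- The trace of `Wᴴ * W` does not change under left and right unitary multiplication. -/
theorem trace_conjTranspose_mul_self_unitary {n m : ℕ} {U : Matrix (Fin n) (Fin n) ℂ}
    {V : Matrix (Fin m) (Fin m) ℂ} (hU : Uᴴ * U = 1) (hV : Vᴴ * V = 1)
    (W : Matrix (Fin n) (Fin m) ℂ) :
    ((U * W * Vᴴ)ᴴ * (U * W * Vᴴ)).trace = (Wᴴ * W).trace := by
  have h : (U * W * Vᴴ)ᴴ * (U * W * Vᴴ) = V * (Wᴴ * (Uᴴ * U) * W * Vᴴ) := by
    simp only [conjTranspose_mul, conjTranspose_conjTranspose, Matrix.mul_assoc]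
  rw [h, trace_mul_comm, hU, Matrix.mul_one, Matrix.mul_assoc, hV, Matrix.mul_one]

theorem trace_conj_mul_conjTranspose_mul_conj_mul {n m : ℕ} {U : Matrix (Fin n) (Fin n) ℂ}
    {V : Matrix (Fin m) (Fin m) ℂ} (hU : Uᴴ * U = 1) (hV : Vᴴ * V = 1)
    (D : Matrix (Fin m) (Fin m) ℂ) (G : Matrix (Fin n) (Fin n) ℂ)
    (W : Matrix (Fin n) (Fin m) ℂ) :
    ((V * D * Vᴴ) * (U * W * Vᴴ)ᴴ * (U * G * Uᴴ) * (U * W * Vᴴ)).trace =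
      (D * Wᴴ * G * W).trace := by
  have h : (V * D * Vᴴ) * (U * W * Vᴴ)ᴴ * (U * G * Uᴴ) * (U * W * Vᴴ) =
      V * (D * (Vᴴ * V) * Wᴴ * (Uᴴ * U) * G * (Uᴴ * U) * W * Vᴴ) := by
    simp only [conjTranspose_mul, conjTranspose_conjTranspose, Matrix.mul_assoc]
  rw [h, trace_mul_comm, hU, hV]
  simp only [Matrix.mul_one, Matrix.mul_assoc, hV]

/-- The unnormalised Gaussian integral of a quadratic form given by two Hermitian matrices in
diagonalised form. -/
theorem integral_gaussian_trace_conj_diagonal {n m : ℕ} {U : Matrix (Fin n) (Fin n) ℂ}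
    {V : Matrix (Fin m) (Fin m) ℂ} (hU : U * Uᴴ = 1) (hU' : Uᴴ * U = 1)
    (hV : V * Vᴴ = 1) (hV' : Vᴴ * V = 1) (x : Fin m → ℂ) (g : Fin n → ℂ) (a k : ℂ)
    (ha : 0 < a.re) (hb : ∀ i j, 0 < (a + k * (x j * g i)).re) :
    ∫ W : Fin n → Fin m → ℂ, Complex.exp (-a * ((Matrix.of W)ᴴ * Matrix.of W).trace) *
        Complex.exp (-k * ((V * diagonal x * Vᴴ) * (Matrix.of W)ᴴ *
          (U * diagonal g * Uᴴ) * Matrix.of W).trace) =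
      (∏ i, ∏ j, a / (a + k * (x j * g i))) *
        ∫ W : Fin n → Fin m → ℂ, Complex.exp (-a * ((Matrix.of W)ᴴ * Matrix.of W).trace) := by
  obtain ⟨r, hr, hF⟩ := exists_integral_comp_mul_mul n m hU hU' hV' hV
  have hlhs := hF fun W => Complex.exp (-a * (Wᴴ * W).trace) *
    Complex.exp (-k * ((V * diagonal x * Vᴴ) * Wᴴ * (U * diagonal g * Uᴴ) * W).trace)
  have hrhs := hF fun W => Complex.exp (-a * (Wᴴ * W).trace)
  simp only [trace_conjTranspose_mul_self_unitary hU' hV',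
    trace_conj_mul_conjTranspose_mul_conj_mul hU' hV'] at hlhs hrhs
  apply smul_right_injective ℂ hr
  simp only
  rw [← mul_smul_comm, ← hlhs, ← hrhs]
  simp only [trace_diagonal_mul_conjTranspose_mul_diagonal_mul,
    trace_conjTranspose_mul_self_eq_sum, ← Complex.exp_add, Finset.mul_sum,
    ← Finset.sum_add_distrib, Matrix.of_apply]
  have ha0 : a ≠ 0 := fun h => by simp [h] at ha
  rw [integral_cexp_neg_sum_mul_norm_sq (b := fun _ _ => a) fun _ _ => ha]
  have hsum : ∀ W : Fin n → Fin m → ℂ,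
      ∑ i, ∑ j, (-a * (‖W i j‖ : ℂ) ^ 2 + -k * (x j * g i * (‖W i j‖ : ℂ) ^ 2)) =
        ∑ i, ∑ j, -(a + k * (x j * g i)) * (‖W i j‖ : ℂ) ^ 2 := fun W =>
    Finset.sum_congr rfl fun i _ => Finset.sum_congr rfl fun j _ => by ring
  simp only [hsum]
  rw [integral_cexp_neg_sum_mul_norm_sq hb]
  simp only [← Finset.prod_mul_distrib]
  refine Finset.prod_congr rfl fun i _ => Finset.prod_congr rfl fun j _ => ?_
  field_simp

/-- For `N, M ≥ 1`, `γ > 0`, `ρ > 0`, `H` an `N×N` Hermitian matrix,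
`E` real not an eigenvalue of `H` (i.e. `det(E·1_N - H) ≠ 0`), and `X` an `M×M`
Hermitian matrix with eigenvalues `x_1, …, x_M`, the Gaussian average (density
proportional to `exp(-(N/γ)·Tr(W†W))`) satisfies
`E_W[exp(-(i/(πρ))·Tr(X W† (E·1_N - H)⁻¹ W))]
   = ∏_c det(E·1_N - H)/det((E + iγx_c/(πNρ))·1_N - H)`. -/
theorem gaussian_average_resolvent (N M : ℕ) (hN : 1 ≤ N) (hM : 1 ≤ M)
    (γ : ℝ) (hγ : 0 < γ) (ρ : ℝ) (hρ : 0 < ρ)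
    (H : Matrix (Fin N) (Fin N) ℂ) (hH : H.IsHermitian) (E : ℝ)
    (hE : Matrix.det ((E : ℂ) • (1 : Matrix (Fin N) (Fin N) ℂ) - H) ≠ 0)
    (X : Matrix (Fin M) (Fin M) ℂ) (hX : X.IsHermitian) :
    (∫ W : Fin N → Fin M → ℂ,
        Complex.exp (-((N : ℂ) / (γ : ℂ)) * Matrix.trace ((Matrix.of W)ᴴ * Matrix.of W)) *
          Complex.exp (-(Complex.I / ((Real.pi : ℂ) * (ρ : ℂ))) *
            Matrix.trace (X * (Matrix.of W)ᴴ *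
              ((E : ℂ) • (1 : Matrix (Fin N) (Fin N) ℂ) - H)⁻¹ * Matrix.of W)))
      = (∏ c : Fin M,
          Matrix.det ((E : ℂ) • (1 : Matrix (Fin N) (Fin N) ℂ) - H) /
            Matrix.det (((E : ℂ) + Complex.I * (γ : ℂ) * (hX.eigenvalues c : ℂ) /
                ((Real.pi : ℂ) * (N : ℂ) * (ρ : ℂ))) • (1 : Matrix (Fin N) (Fin N) ℂ) - H)) *
        ∫ W : Fin N → Fin M → ℂ,
          Complex.exp (-((N : ℂ) / (γ : ℂ)) * Matrix.trace ((Matrix.of W)ᴴ * Matrix.of W)) := by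
  obtain ⟨U, hU', hU, hHU⟩ := exists_unitary_diagonalization hH
  obtain ⟨V, hV', hV, hXV⟩ := exists_unitary_diagonalization hX
  generalize hX.eigenvalues = x at hXV ⊢
  generalize hH.eigenvalues = h at hHU
  have hNr : (N : ℂ) ≠ 0 := Nat.cast_ne_zero.mpr (by omega)
  have hγc : (γ : ℂ) ≠ 0 := Complex.ofReal_ne_zero.mpr hγ.ne'
  have hρc : (ρ : ℂ) ≠ 0 := Complex.ofReal_ne_zero.mpr hρ.ne'
  have hπc : (Real.pi : ℂ) ≠ 0 := Complex.ofReal_ne_zero.mpr Real.pi_ne_zero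
  have hNpos : (0 : ℝ) < N := Nat.cast_pos.mpr hN
  subst hHU hXV
  simp only [smul_one_sub_conj_diagonal hU, det_conj_diagonal hU] at hE ⊢
  have hd : ∀ i, (E : ℂ) - h i ≠ 0 := fun i => Finset.prod_ne_zero_iff.mp hE i (Finset.mem_univ i)
  have hre : ∀ i j, ((N : ℂ) / γ +
      Complex.I / (Real.pi * ρ) * ((x j : ℂ) * ((E : ℂ) - h i)⁻¹)).re = N / γ := fun i j => by
    have hcast : (N : ℂ) / γ + Complex.I / (Real.pi * ρ) * ((x j : ℂ) * ((E : ℂ) - h i)⁻¹) =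
        ((N / γ : ℝ) : ℂ) + ((x j * (E - h i)⁻¹ / (Real.pi * ρ) : ℝ) : ℂ) * Complex.I := by
      push_cast; ring
    rw [hcast, Complex.add_re, Complex.ofReal_re, Complex.re_ofReal_mul, Complex.I_re, mul_zero,
      add_zero]
  have ha : ((N : ℂ) / γ).re = N / γ := by
    rw [← Complex.ofReal_natCast, ← Complex.ofReal_div, Complex.ofReal_re]
  rw [inv_conj_diagonal hU hU' hd,
    integral_gaussian_trace_conj_diagonal hU hU' hV hV' (fun j => (x j : ℂ)) _ _ _
      (by rw [ha]; positivity) (fun i j => by rw [hre]; positivity)]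
  congr 1
  rw [Finset.prod_comm]
  refine Finset.prod_congr rfl fun j _ => ?_
  rw [← Finset.prod_div_distrib]
  refine Finset.prod_congr rfl fun i _ => ?_
  have hz : (N : ℂ) / γ + Complex.I / (Real.pi * ρ) * ((x j : ℂ) * ((E : ℂ) - h i)⁻¹) =
      (N : ℂ) / γ * (((E : ℂ) + Complex.I * γ * x j / (Real.pi * N * ρ) - h i) /
        ((E : ℂ) - h i)) := by
    have := hd i
    field_simp
    ring
  rw [hz, div_mul_cancel_left₀ (div_ne_zero hNr hγc), inv_div]
end
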